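/- Let d ≥ 1, let f₁, f₂ : ℝ^d → ℝ^d be infinitely differentiable, let D ⊆ ℝ^d be open and τ > 0, and suppose that for every x ∈ D there is a differentiable curve γ_x : [0, τ] → D with γ_x(0) = x and γ_x′(t) = [f₁,f₂](γ_x(t)) for all t ∈ [0, τ], where [f₁,f₂](x) = Df₂(x)·f₁(x) − Df₁(x)·f₂(x). Then for every compact set K ⊆ D there exist N ∈ ℕ and constants C, L > 0 such that for every integer n > N, setting Δt = τ/n, the following holds for every x ∈ K: there exists a piecewise solution from x for the sequence of 4n vector fields consisting of the block (−f₁, −f₂, f₁, f₂) repeated n times, each with time √Δt, and every such piecewise solution η satisfies ‖η(4n√Δt) − γ_x(τ)‖ ≤ C τ e^{Lτ} √Δt. -/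

import Mathlib

noncomputable section

/-- `Euc d` is the Euclidean space `ℝ^d`. -/
abbrev Euc (d : ℕ) := EuclideanSpace ℝ (Fin d)

/-- A piecewise solution from `x` for the vector fields `g 0, …, g (n-1)` with times
`τ 0, …, τ (n-1)`: a curve, continuous on `[0, T]` with `T = τ 0 + ⋯ + τ (n-1)`, starting at `x`,
which on each open subinterval `(t_{i}, t_{i+1})` solves `γ' = g i (γ)`. -/
def IsPiecewiseSolution {d : ℕ} (n : ℕ) (g : ℕ → Euc d → Euc d) (τ : ℕ → ℝ)
    (x : Euc d) (γ : ℝ → Euc d) : Prop :=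
  ContinuousOn γ (Set.Icc 0 (∑ j ∈ Finset.range n, τ j)) ∧ γ 0 = x ∧
  ∀ i < n, ∀ t ∈ Set.Ioo (∑ j ∈ Finset.range i, τ j) (∑ j ∈ Finset.range (i + 1), τ j),
    HasDerivAt γ (g i (γ t)) t

/-- The Lie bracket `[f₁, f₂](x) = Df₂(x)·f₁(x) − Df₁(x)·f₂(x)` of two vector fields. -/
def lieBracket {d : ℕ} (f₁ f₂ : Euc d → Euc d) : Euc d → Euc d :=
  fun x => fderiv ℝ f₂ x (f₁ x) - fderiv ℝ f₁ x (f₂ x)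

/-- The cyclic block of vector fields `(−f₁, −f₂, f₁, f₂)` used to approximate the flow of the
Lie bracket `[f₁, f₂]`. -/
def lieBlock {d : ℕ} (f₁ f₂ : Euc d → Euc d) : ℕ → Euc d → Euc d :=
  fun k => if k % 4 = 0 then (fun x => -(f₁ x))
    else if k % 4 = 1 then (fun x => -(f₂ x))
    else if k % 4 = 2 then f₁ else f₂

open Set Filter Topology

/-- The curve `y` is continuous on `[a, b]` and solves `y' = v(y)` on `(a, b)`. -/
def SolvesOn {E : Type*} [NormedAddCommGroup E] [NormedSpace ℝ E]
    (v : E → E) (a b : ℝ) (y : ℝ → E) : Prop :=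
  ContinuousOn y (Icc a b) ∧ ∀ t ∈ Ioo a b, HasDerivAt y (v (y t)) t

/-- The vector field `v` is differentiable, and `v`, its derivative and the Lipschitz constant of
its derivative are bounded by `M`. -/
structure IsC2Bounded {E : Type*} [NormedAddCommGroup E] [NormedSpace ℝ E]
    (M : ℝ) (v : E → E) : Prop where
  differentiable : Differentiable ℝ v
  norm_le : ∀ x, ‖v x‖ ≤ M
  norm_fderiv_le : ∀ x, ‖fderiv ℝ v x‖ ≤ M
  norm_fderiv_sub_le : ∀ x y, ‖fderiv ℝ v x - fderiv ℝ v y‖ ≤ M * ‖x - y‖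

/-- The point `z` agrees with `x + h p + h² q` up to an error `A h³`, with `p`, `q` bounded
by `A`. -/
def HasExpansion {E : Type*} [NormedAddCommGroup E] [NormedSpace ℝ E]
    (A h : ℝ) (x p q z : E) : Prop :=
  ‖p‖ ≤ A ∧ ‖q‖ ≤ A ∧ ‖z - (x + h • p + h ^ 2 • q)‖ ≤ A * h ^ 3

section General

variable {E : Type*} [NormedAddCommGroup E] [NormedSpace ℝ E]

namespace SolvesOn

variable {v w : E → E} {a b : ℝ} {y : ℝ → E}

theorem hasDerivWithinAt (hy : SolvesOn v a b y) (hv : Continuous v) :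
    ∀ t ∈ Ico a b, HasDerivWithinAt y (v (y t)) (Ici t) t := by
  rintro t ⟨hat, htb⟩
  rcases hat.eq_or_lt with rfl | hat
  · have hcont : ContinuousWithinAt y (Icc a b) a := hy.1 a ⟨le_rfl, htb.le⟩
    refine hasDerivWithinAt_Ici_of_tendsto_deriv (s := Ioo a b)
      (fun t ht => (hy.2 t ht).differentiableAt.differentiableWithinAt)
      (hcont.mono Ioo_subset_Icc_self) (Ioo_mem_nhdsGT htb) ?_
    have h1 : Tendsto y (𝓝[>] a) (𝓝 (y a)) := by
      have := (hcont.mono Ioo_subset_Icc_self).tendsto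
      rwa [nhdsWithin_Ioo_eq_nhdsGT htb] at this
    refine ((hv.tendsto _).comp h1).congr' ?_
    filter_upwards [Ioo_mem_nhdsGT htb] with s hs
    exact (hy.2 s hs).deriv.symm
  · exact (hy.2 t ⟨hat, htb⟩).hasDerivWithinAt

theorem congr (hy : SolvesOn v a b y) (h : ∀ t ∈ Ioo a b, v (y t) = w (y t)) :
    SolvesOn w a b y :=
  ⟨hy.1, fun t ht => h t ht ▸ hy.2 t ht⟩

theorem mono (hy : SolvesOn v a b y) {c e : ℝ} (hc : a ≤ c) (he : e ≤ b) :
    SolvesOn v c e y :=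
  ⟨hy.1.mono (Icc_subset_Icc hc he), fun t ht => hy.2 t ⟨hc.trans_lt ht.1, ht.2.trans_le he⟩⟩

end SolvesOn

namespace IsC2Bounded

variable {v w : E → E} {M : ℝ}

theorem nonneg (hv : IsC2Bounded M v) : 0 ≤ M := (norm_nonneg _).trans (hv.norm_le 0)

theorem neg (hv : IsC2Bounded M v) : IsC2Bounded M (fun x => -(v x)) where
  differentiable := hv.differentiable.neg
  norm_le x := by simpa using hv.norm_le x
  norm_fderiv_le x := by simpa [fderiv_fun_neg] using hv.norm_fderiv_le x
  norm_fderiv_sub_le x y := by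
    have := hv.norm_fderiv_sub_le y x
    rw [norm_sub_rev y x] at this
    simpa [fderiv_fun_neg, neg_add_eq_sub] using this

theorem mono (hv : IsC2Bounded M v) {N : ℝ} (h : M ≤ N) : IsC2Bounded N v where
  differentiable := hv.differentiable
  norm_le x := (hv.norm_le x).trans h
  norm_fderiv_le x := (hv.norm_fderiv_le x).trans h
  norm_fderiv_sub_le x y := (hv.norm_fderiv_sub_le x y).trans (by gcongr)

theorem norm_sub_le (hv : IsC2Bounded M v) (x y : E) : ‖v x - v y‖ ≤ M * ‖x - y‖ :=
  convex_univ.norm_image_sub_le_of_norm_fderiv_le (𝕜 := ℝ)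
    (fun z _ => hv.differentiable z) (fun z _ => hv.norm_fderiv_le z) (mem_univ _) (mem_univ _)

theorem lipschitzWith (hv : IsC2Bounded M v) : LipschitzWith M.toNNReal v :=
  LipschitzWith.of_dist_le_mul fun x y => by
    simpa [dist_eq_norm, Real.coe_toNNReal _ hv.nonneg] using hv.norm_sub_le x y

theorem norm_taylor_le (hv : IsC2Bounded M v) (x y : E) :
    ‖v y - v x - fderiv ℝ v x (y - x)‖ ≤ M * ‖y - x‖ ^ 2 := by
  have hM := hv.nonneg
  have := (convex_closedBall x ‖y - x‖).norm_image_sub_le_of_norm_fderiv_le' (𝕜 := ℝ) (f := v)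
    (φ := fderiv ℝ v x) (C := M * ‖y - x‖) (x := x) (y := y)
    (fun z _ => hv.differentiable z)
    (fun z hz => (hv.norm_fderiv_sub_le z x).trans
      (by
        rw [mem_closedBall_iff_norm] at hz
        gcongr))
    (Metric.mem_closedBall_self (norm_nonneg _)) (mem_closedBall_iff_norm.2 le_rfl)
  rwa [mul_assoc, ← sq] at this

theorem norm_curve_sub_le (hv : IsC2Bounded M v) {a b : ℝ} {y : ℝ → E} (hy : SolvesOn v a b y) :
    ∀ t ∈ Icc a b, ‖y t - y a‖ ≤ M * (t - a) :=
  norm_image_sub_le_of_norm_deriv_right_le_segment hy.1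
    (hy.hasDerivWithinAt hv.differentiable.continuous) fun _ _ => hv.norm_le _

theorem norm_curve_taylor_le (hv : IsC2Bounded M v) {a h : ℝ} (hh : 0 ≤ h) {y : ℝ → E}
    (hy : SolvesOn v a (a + h) y) :
    ‖y (a + h) - (y a + h • v (y a) + (h ^ 2 / 2) • fderiv ℝ v (y a) (v (y a)))‖
      ≤ 2 * M ^ 3 * h ^ 3 := by
  have hM := hv.nonneg
  have hd := hy.hasDerivWithinAt hv.differentiable.continuous
  have h0 : ∀ t ∈ Icc a (a + h), ‖y t - y a‖ ≤ M * h := fun t ht =>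
    (hv.norm_curve_sub_le hy t ht).trans (by gcongr; linarith [ht.2])
  have hlin : ∀ t : ℝ, HasDerivAt (fun s : ℝ => s - a) 1 t := fun t =>
    (hasDerivAt_id t).sub_const a
  have h1 : ∀ t ∈ Icc a (a + h), ‖y t - y a - (t - a) • v (y a)‖ ≤ M ^ 2 * h ^ 2 := by
    intro t ht
    have := norm_image_sub_le_of_norm_deriv_right_le_segment
      (f := fun t => y t - (t - a) • v (y a)) (f' := fun t => v (y t) - (1 : ℝ) • v (y a))
      (C := M * (M * h)) (a := a) (b := a + h)
      (hy.1.sub (by fun_prop))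
      (fun t ht => (hd t ht).sub ((hlin t).smul_const _).hasDerivWithinAt)
      (fun t ht => by
        rw [one_smul]
        exact (hv.norm_sub_le _ _).trans (by gcongr; exact h0 t (Ico_subset_Icc_self ht))) t ht
    rw [sub_self, zero_smul, sub_zero] at this
    rw [sub_right_comm]
    refine this.trans ?_
    have : t - a ≤ h := by linarith [ht.2]
    calc M * (M * h) * (t - a) ≤ M * (M * h) * h := by gcongr
      _ = _ := by ring
  have := norm_image_sub_le_of_norm_deriv_right_le_segment
      (f := fun t => y t - (t - a) • v (y a) - ((t - a) ^ 2 / 2) • fderiv ℝ v (y a) (v (y a)))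
      (f' := fun t => v (y t) - (1 : ℝ) • v (y a)
        - ((2 * (t - a)) / 2) • fderiv ℝ v (y a) (v (y a)))
      (C := 2 * M ^ 3 * h ^ 2) (a := a) (b := a + h)
      ((hy.1.sub (by fun_prop)).sub (by fun_prop))
      (fun t ht => ((hd t ht).sub ((hlin t).smul_const _).hasDerivWithinAt).sub
        (by
          have := (((hlin t).pow 2).div_const 2).smul_const (fderiv ℝ v (y a) (v (y a)))
          simpa using this.hasDerivWithinAt))
      (fun t ht => by
        have ht' := Ico_subset_Icc_self ht
        have e : v (y t) - (1 : ℝ) • v (y a) - ((2 * (t - a)) / 2) • fderiv ℝ v (y a) (v (y a))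
            = (v (y t) - v (y a) - fderiv ℝ v (y a) (y t - y a))
              + fderiv ℝ v (y a) (y t - y a - (t - a) • v (y a)) := by
          rw [map_sub _ (y t - y a), map_smul, one_smul, mul_div_cancel_left₀ _ (two_ne_zero)]
          abel
        rw [e]
        calc _ ≤ M * ‖y t - y a‖ ^ 2 + M * ‖y t - y a - (t - a) • v (y a)‖ :=
              norm_add_le_of_le (hv.norm_taylor_le _ _)
                ((fderiv ℝ v (y a)).le_of_opNorm_le (hv.norm_fderiv_le _) _)
          _ ≤ M * (M * h) ^ 2 + M * (M ^ 2 * h ^ 2) := by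
              gcongr
              exacts [h0 t ht', h1 t ht']
          _ = _ := by ring)
      (a + h) ⟨by linarith, le_rfl⟩
  simp only [add_sub_cancel_left, sub_self, zero_smul, sub_zero] at this
  calc _ = _ := by congr 1; simp; abel
    _ ≤ _ := this
    _ = _ := by ring

/-- Following a flow for time `h` transforms second-order expansions into second-order
expansions. -/
theorem hasExpansion_flow (M A : ℝ) :
    ∃ A' : ℝ, ∀ (v : E → E) (a h : ℝ) (y : ℝ → E) (x p q : E), IsC2Bounded M v → 0 ≤ h → h ≤ 1 →
      SolvesOn v a (a + h) y → HasExpansion A h x p q (y a) →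
      HasExpansion A' h x (p + v x)
        (q + (1 / 2 : ℝ) • fderiv ℝ v x (v x) + fderiv ℝ v x p) (y (a + h)) := by
  refine ⟨|A| + |M| + |M| * |A| + |M| ^ 2 + 2 * |M| ^ 3 + |A| + 9 * |M| * |A| ^ 2
    + 2 * |A| * |M| + 3 * |A| * |M| ^ 2, ?_⟩
  rintro v a h y x p q hv h0 h1 hy ⟨hp, hq, hz⟩
  have hM := hv.nonneg
  have hA : 0 ≤ A := (norm_nonneg _).trans hp
  rw [abs_of_nonneg hM, abs_of_nonneg hA]
  have hDp : ∀ z e, ‖fderiv ℝ v z e‖ ≤ M * ‖e‖ := fun z e =>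
    (fderiv ℝ v z).le_of_opNorm_le (hv.norm_fderiv_le _) _
  set z := y a with hz_def
  have h2 : h ^ 2 ≤ h := by nlinarith
  have h3 : h ^ 3 ≤ h ^ 2 := by nlinarith [sq_nonneg h]
  have hz2 : ‖z - x - h • p‖ ≤ 2 * A * h ^ 2 := by
    calc ‖z - x - h • p‖ = ‖(z - (x + h • p + h ^ 2 • q)) + h ^ 2 • q‖ := by congr 1; abel
      _ ≤ A * h ^ 3 + h ^ 2 * A := norm_add_le_of_le hz (by
          rw [norm_smul, Real.norm_of_nonneg (by positivity)]; gcongr)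
      _ ≤ A * h ^ 2 + h ^ 2 * A := by gcongr
      _ = _ := by ring
  have hz1 : ‖z - x‖ ≤ 3 * A * h := by
    calc ‖z - x‖ = ‖(z - x - h • p) + h • p‖ := by congr 1; abel
      _ ≤ 2 * A * h ^ 2 + h * A := norm_add_le_of_le hz2 (by
          rw [norm_smul, Real.norm_of_nonneg (by positivity)]; gcongr)
      _ ≤ 2 * A * h + h * A := by gcongr
      _ = _ := by ring
  have t2 : ‖v z - v x - h • fderiv ℝ v x p‖ ≤ (9 * M * A ^ 2 + 2 * A * M) * h ^ 2 := by
    calc ‖v z - v x - h • fderiv ℝ v x p‖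
        = ‖(v z - v x - fderiv ℝ v x (z - x)) + fderiv ℝ v x (z - x - h • p)‖ := by
          congr 1; rw [map_sub _ (z - x), map_smul]; abel
      _ ≤ M * ‖z - x‖ ^ 2 + M * ‖z - x - h • p‖ :=
          norm_add_le_of_le (hv.norm_taylor_le _ _) (hDp _ _)
      _ ≤ M * (3 * A * h) ^ 2 + M * (2 * A * h ^ 2) := by gcongr
      _ = _ := by ring
  have t3 : ‖fderiv ℝ v z (v z) - fderiv ℝ v x (v x)‖ ≤ 6 * A * M ^ 2 * h := by
    calc ‖fderiv ℝ v z (v z) - fderiv ℝ v x (v x)‖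
        = ‖(fderiv ℝ v z - fderiv ℝ v x) (v z) + fderiv ℝ v x (v z - v x)‖ := by
          congr 1; simp
      _ ≤ (M * ‖z - x‖) * ‖v z‖ + M * ‖v z - v x‖ :=
          norm_add_le_of_le (ContinuousLinearMap.le_of_opNorm_le _ (hv.norm_fderiv_sub_le _ _) _)
            (hDp _ _)
      _ ≤ (M * (3 * A * h)) * M + M * (M * (3 * A * h)) := by
          gcongr
          · exact hv.norm_le _
          · exact (hv.norm_sub_le _ _).trans (by gcongr)
      _ = _ := by ring
  refine ⟨?_, ?_, ?_⟩
  · refine (norm_add_le_of_le hp (hv.norm_le _)).trans ?_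
    have : 0 ≤ M * A + M ^ 2 + 2 * M ^ 3 + A + 9 * M * A ^ 2 + 2 * A * M + 3 * A * M ^ 2 := by
      positivity
    linarith
  · have e1 : ‖(1 / 2 : ℝ) • fderiv ℝ v x (v x)‖ ≤ 1 / 2 * (M * M) := by
      rw [norm_smul, Real.norm_of_nonneg (by positivity)]
      gcongr
      exact (hDp _ _).trans (by gcongr; exact hv.norm_le _)
    have e2 : ‖fderiv ℝ v x p‖ ≤ M * A := (hDp _ _).trans (by gcongr)
    refine (norm_add_le_of_le (norm_add_le_of_le hq e1) e2).trans ?_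
    have : 0 ≤ M + M ^ 2 / 2 + 2 * M ^ 3 + A + 9 * M * A ^ 2 + 2 * A * M + 3 * A * M ^ 2 := by
      positivity
    linarith
  · have t1 := hv.norm_curve_taylor_le h0 hy
    rw [← hz_def] at t1
    calc _ = ‖(y (a + h) - (z + h • v z + (h ^ 2 / 2) • fderiv ℝ v z (v z)))
          + (z - (x + h • p + h ^ 2 • q)) + h • (v z - v x - h • fderiv ℝ v x p)
          + (h ^ 2 / 2) • (fderiv ℝ v z (v z) - fderiv ℝ v x (v x))‖ := by
          congr 1; module
      _ ≤ 2 * M ^ 3 * h ^ 3 + A * h ^ 3 + h * ((9 * M * A ^ 2 + 2 * A * M) * h ^ 2)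
          + (h ^ 2 / 2) * (6 * A * M ^ 2 * h) := by
          refine norm_add_le_of_le (norm_add_le_of_le (norm_add_le_of_le t1 hz) ?_) ?_
          · rw [norm_smul, Real.norm_of_nonneg h0]; gcongr
          · rw [norm_smul, Real.norm_of_nonneg (by positivity)]; gcongr
      _ = (2 * M ^ 3 + A + 9 * M * A ^ 2 + 2 * A * M + 3 * A * M ^ 2) * h ^ 3 := by ring
      _ ≤ _ := by
          gcongr
          have : 0 ≤ A + M + M * A + M ^ 2 := by positivity
          linarith

theorem of_hasCompactSupport [FiniteDimensional ℝ E] (hc : HasCompactSupport v)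
    (hs : ContDiff ℝ (⊤ : ℕ∞) v) : ∃ M, IsC2Bounded M v := by
  obtain ⟨A, hA⟩ := hc.exists_bound_of_continuous hs.continuous
  have hs' : ContDiff ℝ 1 (fderiv ℝ v) := hs.fderiv_right (WithTop.coe_le_coe.2 le_top : ((2 : ℕ∞) : WithTop ℕ∞) ≤ (⊤ : ℕ∞))
  have hc' := hc.fderiv ℝ
  obtain ⟨B, hB⟩ := hc'.exists_bound_of_continuous hs'.continuous
  obtain ⟨C, hC⟩ := hs'.lipschitzWith_of_hasCompactSupport hc' one_ne_zero
  refine ⟨max (max A B) C, hs.differentiable (by simp), fun x => (hA x).trans (by simp),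
    fun x => (hB x).trans (by simp), fun x y => ?_⟩
  have := hC.dist_le_mul x y
  rw [dist_eq_norm, dist_eq_norm] at this
  exact this.trans (by gcongr; simp)

end IsC2Bounded

theorem exists_solvesOn [CompleteSpace E] {v : E → E} {L : ℝ} {K : NNReal}
    (hL : ∀ x, ‖v x‖ ≤ L) (hK : LipschitzWith K v) {T : ℝ} (hT : 0 ≤ T) (x : E) :
    ∃ y : ℝ → E, y 0 = x ∧ SolvesOn v 0 T y := by
  have hL0 : 0 ≤ L := (norm_nonneg _).trans (hL 0)
  have hPL : IsPicardLindelof (fun _ => v) (tmin := 0) (tmax := T) ⟨0, le_rfl, hT⟩ x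
      (L * T).toNNReal 0 L.toNNReal K :=
    .of_time_independent (fun z _ => by simpa [hL0] using hL z) hK.lipschitzOnWith
      (by simp [hT, hL0, Real.coe_toNNReal _ (mul_nonneg hL0 hT)])
  obtain ⟨y, hy0, hy⟩ := hPL.exists_eq_forall_mem_Icc_hasDerivWithinAt₀
  exact ⟨y, hy0, fun t ht => (hy t ht).continuousWithinAt, fun t ht =>
    (hy t (Ioo_subset_Icc_self ht)).hasDerivAt (Icc_mem_nhds ht.1 ht.2)⟩

theorem exists_isC2Bounded_eventuallyEq {E : Type*} [NormedAddCommGroup E] [InnerProductSpace ℝ E]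
    [FiniteDimensional ℝ E] {f : E → E} (hf : ContDiff ℝ (⊤ : ℕ∞) f) (R : ℝ) :
    ∃ M g, IsC2Bounded M g ∧ ∀ x : E, ‖x‖ ≤ R → g =ᶠ[𝓝 x] f := by
  let b : ContDiffBump (0 : E) := ⟨|R| + 1, |R| + 2, by positivity, by linarith⟩
  obtain ⟨M, hM⟩ := IsC2Bounded.of_hasCompactSupport (v := fun x => b x • f x)
    (b.hasCompactSupport.smul_right) (b.contDiff.smul hf)
  refine ⟨M, _, hM, fun x hx => ?_⟩
  have hxb : x ∈ Metric.ball (0 : E) b.rIn := by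
    rw [mem_ball_zero_iff]
    show ‖x‖ < |R| + 1
    linarith [le_abs_self R]
  filter_upwards [b.eventuallyEq_one_of_mem_ball hxb] with z hz
  simp [hz]

theorem SolvesOn.eqOn {E : Type*} [NormedAddCommGroup E] [InnerProductSpace ℝ E]
    [FiniteDimensional ℝ E] {v : E → E} {a b : ℝ} {y z : ℝ → E} (hv : ContDiff ℝ (⊤ : ℕ∞) v)
    (hy : SolvesOn v a b y) (hz : SolvesOn v a b z) (h : y a = z a) : EqOn y z (Icc a b) := by
  obtain ⟨A, hA⟩ := isCompact_Icc.exists_bound_of_continuousOn hy.1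
  obtain ⟨B, hB⟩ := isCompact_Icc.exists_bound_of_continuousOn hz.1
  obtain ⟨M, g, hg, hgv⟩ := exists_isC2Bounded_eventuallyEq hv (max A B)
  have hgc := hg.differentiable.continuous
  have hy' : SolvesOn g a b y := hy.congr fun t ht =>
    (hgv _ ((hA t (Ioo_subset_Icc_self ht)).trans (le_max_left _ _))).eq_of_nhds.symm
  have hz' : SolvesOn g a b z := hz.congr fun t ht =>
    (hgv _ ((hB t (Ioo_subset_Icc_self ht)).trans (le_max_right _ _))).eq_of_nhds.symm
  exact ODE_solution_unique (v := fun _ => g) (fun _ => hg.lipschitzWith) hy'.1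
    (hy'.hasDerivWithinAt hgc) hz'.1 (hz'.hasDerivWithinAt hgc) h

end General

section Euclidean

variable {d : ℕ} {f₁ f₂ g₁ g₂ : Euc d → Euc d}

theorem isPiecewiseSolution_const_iff {n : ℕ} {g : ℕ → Euc d → Euc d} {h : ℝ} (hh : 0 ≤ h)
    {x : Euc d} {η : ℝ → Euc d} :
    IsPiecewiseSolution n g (fun _ => h) x η ↔ ContinuousOn η (Icc 0 (n * h)) ∧ η 0 = x ∧
      ∀ i < n, SolvesOn (g i) (i * h) (i * h + h) η := by
  simp only [IsPiecewiseSolution, Finset.sum_const, Finset.card_range, nsmul_eq_mul, SolvesOn,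
    Nat.cast_add, Nat.cast_one, add_mul, one_mul]
  refine ⟨fun ⟨h1, h2, h3⟩ => ⟨h1, h2, fun i hi => ⟨h1.mono (Icc_subset_Icc (by positivity) ?_),
    h3 i hi⟩⟩, fun ⟨h1, h2, h3⟩ => ⟨h1, h2, fun i hi => (h3 i hi).2⟩⟩
  have : (i : ℝ) + 1 ≤ n := by exact_mod_cast hi
  nlinarith

theorem exists_isPiecewiseSolution {g : ℕ → Euc d → Euc d} {h : ℝ} (hh : 0 ≤ h)
    (hg : ∀ i x, ∃ y : ℝ → Euc d, y 0 = x ∧ SolvesOn (g i) 0 h y) (n : ℕ) (x : Euc d) :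
    ∃ η, IsPiecewiseSolution n g (fun _ => h) x η := by
  simp only [isPiecewiseSolution_const_iff hh]
  induction n with
  | zero => exact ⟨fun _ => x, continuousOn_const, rfl, by simp⟩
  | succ n ih =>
    obtain ⟨η, hc, h0, hs⟩ := ih
    obtain ⟨y, hy0, hyc, hy⟩ := hg n (η (n * h))
    have hn : 0 ≤ (n : ℝ) * h := by positivity
    set ζ : ℝ → Euc d := fun t => if t ≤ n * h then η t else y (t - n * h) with hζ
    have hζ1 : EqOn ζ η (Iic (n * h)) := fun t ht => if_pos ht
    have hζ2 : EqOn ζ (fun t => y (t - n * h)) (Ici (n * h)) := fun t ht => by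
      rcases (mem_Ici.1 ht).eq_or_lt with rfl | ht
      · simp [hζ, hy0]
      · exact if_neg ht.not_ge
    have hc1 : ContinuousOn ζ (Icc 0 (n * h)) := hc.congr (hζ1.mono Icc_subset_Iic_self)
    have hc2 : ContinuousOn ζ (Icc (n * h) (n * h + h)) := by
      refine ContinuousOn.congr ?_ (hζ2.mono Icc_subset_Ici_self)
      exact hyc.comp (by fun_prop) fun t ht => ⟨by linarith [ht.1], by linarith [ht.2]⟩
    refine ⟨ζ, ?_, (hζ1 hn).trans h0, fun i hi => ?_⟩
    · have := hc1.union_of_isClosed hc2 isClosed_Icc isClosed_Icc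
      rw [Icc_union_Icc_eq_Icc hn (by linarith)] at this
      simpa [add_mul] using this
    · rcases (Nat.lt_succ_iff.1 hi).eq_or_lt with rfl | hi
      · refine ⟨hc2, fun t ht => ?_⟩
        rw [hζ2 ht.1.le]
        have := (hy (t - i * h) ⟨by linarith [ht.1], by linarith [ht.2]⟩).comp_sub_const t (i * h)
        refine this.congr_of_eventuallyEq ?_
        filter_upwards [Ioi_mem_nhds ht.1] with s hs using hζ2 (mem_Ioi.1 hs).le
      · have hle : (i : ℝ) * h + h ≤ n * h := by
          have : (i : ℝ) + 1 ≤ n := by exact_mod_cast hi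
          nlinarith
        refine ⟨(hs i hi).1.congr fun t ht => hζ1 (ht.2.trans hle), fun t ht => ?_⟩
        have ht' := ht.2.trans_le hle
        rw [hζ1 ht'.le]
        refine ((hs i hi).2 t ht).congr_of_eventuallyEq ?_
        filter_upwards [Iio_mem_nhds ht'] with s hs using hζ1 (mem_Iio.1 hs).le

theorem IsPiecewiseSolution.eq_of_contDiff {n : ℕ} {g : ℕ → Euc d → Euc d} {h : ℝ} (hh : 0 ≤ h)
    {x : Euc d} {η ζ : ℝ → Euc d} (hg : ∀ i, ContDiff ℝ (⊤ : ℕ∞) (g i))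
    (hη : IsPiecewiseSolution n g (fun _ => h) x η)
    (hζ : IsPiecewiseSolution n g (fun _ => h) x ζ) : ∀ k ≤ n, η (k * h) = ζ (k * h) := by
  rw [isPiecewiseSolution_const_iff hh] at hη hζ
  intro k hk
  induction k with
  | zero => simp [hη.2.1, hζ.2.1]
  | succ k ih =>
    have := (hη.2.2 k hk).eqOn (hg k) (hζ.2.2 k hk) (ih (by omega))
      (right_mem_Icc.2 (by linarith))
    simpa [add_mul] using this

theorem contDiff_lieBracket (hf₁ : ContDiff ℝ (⊤ : ℕ∞) f₁) (hf₂ : ContDiff ℝ (⊤ : ℕ∞) f₂) :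
    ContDiff ℝ (⊤ : ℕ∞) (lieBracket f₁ f₂) :=
  ((hf₂.fderiv_right le_rfl).clm_apply hf₁).sub ((hf₁.fderiv_right le_rfl).clm_apply hf₂)

theorem contDiff_lieBlock (hf₁ : ContDiff ℝ (⊤ : ℕ∞) f₁) (hf₂ : ContDiff ℝ (⊤ : ℕ∞) f₂) (k : ℕ) :
    ContDiff ℝ (⊤ : ℕ∞) (lieBlock f₁ f₂ k) := by
  unfold lieBlock
  split_ifs
  exacts [hf₁.neg, hf₂.neg, hf₁, hf₂]

theorem IsC2Bounded.lieBlock_apply {M : ℝ} (h₁ : IsC2Bounded M g₁) (h₂ : IsC2Bounded M g₂) (k : ℕ) :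
    IsC2Bounded M (lieBlock g₁ g₂ k) := by
  unfold lieBlock
  split_ifs
  exacts [h₁.neg, h₂.neg, h₁, h₂]

theorem lieBlock_eq_of_eventuallyEq {x : Euc d} (h₁ : g₁ =ᶠ[𝓝 x] f₁) (h₂ : g₂ =ᶠ[𝓝 x] f₂)
    (k : ℕ) : lieBlock g₁ g₂ k x = lieBlock f₁ f₂ k x := by
  unfold lieBlock
  split_ifs <;> simp [h₁.eq_of_nhds, h₂.eq_of_nhds]

theorem lieBracket_eq_of_eventuallyEq {x : Euc d} (h₁ : g₁ =ᶠ[𝓝 x] f₁) (h₂ : g₂ =ᶠ[𝓝 x] f₂) :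
    lieBracket g₁ g₂ x = lieBracket f₁ f₂ x := by
  simp [lieBracket, h₁.fderiv_eq, h₂.fderiv_eq, h₁.eq_of_nhds, h₂.eq_of_nhds]

namespace IsC2Bounded

variable {M : ℝ}

theorem norm_lieBracket_le (h₁ : IsC2Bounded M g₁) (h₂ : IsC2Bounded M g₂) (x : Euc d) :
    ‖lieBracket g₁ g₂ x‖ ≤ 2 * M ^ 2 := by
  have hM := h₁.nonneg
  calc _ ≤ M * M + M * M := norm_sub_le_of_le
        (ContinuousLinearMap.le_of_opNorm_le_of_le _ (h₂.norm_fderiv_le x) (h₁.norm_le x))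
        (ContinuousLinearMap.le_of_opNorm_le_of_le _ (h₁.norm_fderiv_le x) (h₂.norm_le x))
    _ = _ := by ring

theorem norm_fderiv_apply_sub_le (h₁ : IsC2Bounded M g₁) (h₂ : IsC2Bounded M g₂) (x y : Euc d) :
    ‖fderiv ℝ g₂ x (g₁ x) - fderiv ℝ g₂ y (g₁ y)‖ ≤ 2 * M ^ 2 * ‖x - y‖ := by
  have hM := h₁.nonneg
  calc ‖fderiv ℝ g₂ x (g₁ x) - fderiv ℝ g₂ y (g₁ y)‖
      = ‖(fderiv ℝ g₂ x - fderiv ℝ g₂ y) (g₁ x) + fderiv ℝ g₂ y (g₁ x - g₁ y)‖ := by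
        congr 1; simp
    _ ≤ M * ‖x - y‖ * M + M * (M * ‖x - y‖) := norm_add_le_of_le
        (ContinuousLinearMap.le_of_opNorm_le_of_le _ (h₂.norm_fderiv_sub_le x y) (h₁.norm_le x))
        (ContinuousLinearMap.le_of_opNorm_le_of_le _ (h₂.norm_fderiv_le y) (h₁.norm_sub_le x y))
    _ = _ := by ring

theorem norm_lieBracket_sub_le (h₁ : IsC2Bounded M g₁) (h₂ : IsC2Bounded M g₂) (x y : Euc d) :
    ‖lieBracket g₁ g₂ x - lieBracket g₁ g₂ y‖ ≤ 4 * M ^ 2 * ‖x - y‖ := by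
  calc _ = ‖(fderiv ℝ g₂ x (g₁ x) - fderiv ℝ g₂ y (g₁ y))
        - (fderiv ℝ g₁ x (g₂ x) - fderiv ℝ g₁ y (g₂ y))‖ := by
        congr 1; simp only [lieBracket]; abel
    _ ≤ 2 * M ^ 2 * ‖x - y‖ + 2 * M ^ 2 * ‖x - y‖ := norm_sub_le_of_le
        (h₁.norm_fderiv_apply_sub_le h₂ x y) (h₂.norm_fderiv_apply_sub_le h₁ x y)
    _ = _ := by ring

theorem lipschitzWith_lieBracket (h₁ : IsC2Bounded M g₁) (h₂ : IsC2Bounded M g₂) :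
    LipschitzWith (4 * M ^ 2).toNNReal (lieBracket g₁ g₂) :=
  LipschitzWith.of_dist_le_mul fun x y => by
    rw [dist_eq_norm, dist_eq_norm, Real.coe_toNNReal _ (by positivity)]
    exact h₁.norm_lieBracket_sub_le h₂ x y

/-- One cycle through the flows of `−g₁, −g₂, g₁, g₂`, each for time `h`, agrees with an Euler
step of length `h²` for the Lie bracket up to third order. -/
theorem exists_norm_cycle_sub_le (M : ℝ) : ∃ C : ℝ, 0 ≤ C ∧ ∀ (g₁ g₂ : Euc d → Euc d),
    IsC2Bounded M g₁ → IsC2Bounded M g₂ → ∀ (a h : ℝ) (y : ℝ → Euc d), 0 ≤ h → h ≤ 1 →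
    SolvesOn (fun x => -(g₁ x)) a (a + h) y → SolvesOn (fun x => -(g₂ x)) (a + h) (a + h + h) y →
    SolvesOn g₁ (a + h + h) (a + h + h + h) y →
    SolvesOn g₂ (a + h + h + h) (a + h + h + h + h) y →
    ‖y (a + h + h + h + h) - (y a + h ^ 2 • lieBracket g₁ g₂ (y a))‖ ≤ C * h ^ 3 := by
  obtain ⟨A₁, hA₁⟩ := hasExpansion_flow (E := Euc d) M 0
  obtain ⟨A₂, hA₂⟩ := hasExpansion_flow (E := Euc d) M A₁
  obtain ⟨A₃, hA₃⟩ := hasExpansion_flow (E := Euc d) M A₂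
  obtain ⟨A₄, hA₄⟩ := hasExpansion_flow (E := Euc d) M A₃
  refine ⟨|A₄|, abs_nonneg _, fun g₁ g₂ h₁ h₂ a h y h0 h1 hs₁ hs₂ hs₃ hs₄ => ?_⟩
  have e0 : HasExpansion 0 h (y a) 0 0 (y a) := by simp [HasExpansion]
  have e1 := hA₁ _ _ _ _ _ _ _ h₁.neg h0 h1 hs₁ e0
  have e2 := hA₂ _ _ _ _ _ _ _ h₂.neg h0 h1 hs₂ e1
  have e3 := hA₃ _ _ _ _ _ _ _ h₁ h0 h1 hs₃ e2
  have e4 := (hA₄ _ _ _ _ _ _ _ h₂ h0 h1 hs₄ e3).2.2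
  calc _ = _ := by
        congr 2
        simp only [lieBracket, fderiv_fun_neg, map_add, map_neg, map_zero,
          neg_apply]
        module
    _ ≤ A₄ * h ^ 3 := e4
    _ ≤ _ := by gcongr; exact le_abs_self _

theorem norm_euler_sub_le (h₁ : IsC2Bounded M g₁) (h₂ : IsC2Bounded M g₂) {a k : ℝ} (hk : 0 ≤ k)
    {y : ℝ → Euc d} (hy : SolvesOn (lieBracket g₁ g₂) a (a + k) y) :
    ‖y (a + k) - (y a + k • lieBracket g₁ g₂ (y a))‖ ≤ 8 * M ^ 4 * k ^ 2 := by
  have hd := hy.hasDerivWithinAt (h₁.lipschitzWith_lieBracket h₂).continuous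
  have hb := norm_image_sub_le_of_norm_deriv_right_le_segment hy.1 hd
    (fun t _ => h₁.norm_lieBracket_le h₂ (y t))
  have := norm_image_sub_le_of_norm_deriv_right_le_segment
    (f := fun t => y t - (t - a) • lieBracket g₁ g₂ (y a))
    (f' := fun t => lieBracket g₁ g₂ (y t) - (1 : ℝ) • lieBracket g₁ g₂ (y a))
    (C := 4 * M ^ 2 * (2 * M ^ 2 * k)) (a := a) (b := a + k)
    (hy.1.sub (by fun_prop))
    (fun t ht => (hd t ht).sub
      ((((hasDerivAt_id t).sub_const a).smul_const _).hasDerivWithinAt))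
    (fun t ht => by
      rw [one_smul]
      refine (h₁.norm_lieBracket_sub_le h₂ _ _).trans ?_
      gcongr
      refine (hb t (Ico_subset_Icc_self ht)).trans ?_
      gcongr
      linarith [ht.2])
    (a + k) ⟨by linarith, le_rfl⟩
  simp only [add_sub_cancel_left, sub_self, zero_smul, sub_zero] at this
  calc _ = _ := by congr 1; abel
    _ ≤ _ := this
    _ = _ := by ring

end IsC2Bounded

theorem le_mul_exp_of_le_one_add_mul {e : ℕ → ℝ} {a b : ℝ} {n : ℕ} (ha : 0 ≤ a) (hb : 0 ≤ b)
    (h0 : e 0 ≤ 0) (h : ∀ k < n, e (k + 1) ≤ (1 + a) * e k + b) :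
    ∀ k ≤ n, e k ≤ k * b * Real.exp (a * k) := by
  intro k hk
  induction k with
  | zero => simpa using h0
  | succ k ih =>
    have h1 : 1 + a ≤ Real.exp a := by linarith [Real.add_one_le_exp a]
    have h2 : 1 ≤ Real.exp (a * (k + 1)) := Real.one_le_exp (by positivity)
    calc e (k + 1) ≤ (1 + a) * e k + b := h k hk
      _ ≤ Real.exp a * (k * b * Real.exp (a * k)) + b * Real.exp (a * (k + 1)) := by
          refine add_le_add ?_ (le_mul_of_one_le_right hb h2)
          exact (mul_le_mul_of_nonneg_left (ih (by omega)) (by linarith)).trans (by gcongr)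
      _ = _ := by
          rw [Nat.cast_succ, mul_add, mul_one, Real.exp_add]
          ring

namespace IsPiecewiseSolution

variable {M : ℝ} {n : ℕ} {h : ℝ} {x : Euc d} {η : ℝ → Euc d}

theorem norm_sub_le {g : ℕ → Euc d → Euc d} (hg : ∀ i, IsC2Bounded M (g i)) (hh : 0 ≤ h)
    (hη : IsPiecewiseSolution n g (fun _ => h) x η) {k j : ℕ} (hkj : k + j ≤ n) :
    ‖η ((k + j : ℕ) * h) - η (k * h)‖ ≤ j * (M * h) := by
  rw [isPiecewiseSolution_const_iff hh] at hη
  induction j with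
  | zero => simp
  | succ j ih =>
    have h1 := (hg _).norm_curve_sub_le (hη.2.2 (k + j) hkj) _ (right_mem_Icc.2 (by linarith))
    rw [add_sub_cancel_left] at h1
    have h2 : ((k + (j + 1) : ℕ) : ℝ) * h = (k + j : ℕ) * h + h := by push_cast; ring
    rw [h2]
    refine (norm_sub_le_norm_sub_add_norm_sub _ _ _).trans ((add_le_add h1 (ih (by omega))).trans ?_)
    push_cast
    linarith

end IsPiecewiseSolution

/-- Error estimate, along the whole trajectory, for the approximation of the flow of the Lie
bracket of two vector fields that are globally bounded in `C²`. -/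
theorem IsC2Bounded.exists_norm_piecewise_sub_le (M : ℝ) : ∃ C L : ℝ, 0 < C ∧ 0 < L ∧
    ∀ (g₁ g₂ : Euc d → Euc d), IsC2Bounded M g₁ → IsC2Bounded M g₂ →
    ∀ τ : ℝ, 0 < τ → ∀ n : ℕ, τ ≤ n → ∀ (x : Euc d) (y η : ℝ → Euc d), y 0 = x →
    SolvesOn (lieBracket g₁ g₂) 0 τ y →
    IsPiecewiseSolution (4 * n) (lieBlock g₁ g₂) (fun _ => Real.sqrt (τ / n)) x η →
    ‖η ((4 * n : ℕ) * Real.sqrt (τ / n)) - y τ‖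
      ≤ C * τ * Real.exp (L * τ) * Real.sqrt (τ / n) ∧
    ∀ i < 4 * n, ∀ t ∈ Icc (i * Real.sqrt (τ / n)) (i * Real.sqrt (τ / n) + Real.sqrt (τ / n)),
      ∃ s ∈ Icc 0 τ, ‖η t - y s‖
        ≤ (C * τ * Real.exp (L * τ) + 4 * M) * Real.sqrt (τ / n) := by
  obtain ⟨C, hC, hcycle⟩ := exists_norm_cycle_sub_le (d := d) M
  refine ⟨C + 8 * M ^ 4 + 1, 4 * M ^ 2 + 1, by positivity, by positivity, ?_⟩
  intro g₁ g₂ h₁ h₂ τ hτ n hn x y η hy0 hy hη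
  have hM := h₁.nonneg
  have hn0 : (0 : ℝ) < n := hτ.trans_le hn
  set h := Real.sqrt (τ / n) with h_def
  have hh : 0 ≤ h := Real.sqrt_nonneg _
  have hsq : h ^ 2 = τ / n := Real.sq_sqrt (by positivity)
  have hnh : n * h ^ 2 = τ := by rw [hsq]; field_simp
  have hh1 : h ≤ 1 := Real.sqrt_le_one.2 ((div_le_one hn0).2 hn)
  have hg := h₁.lieBlock_apply h₂
  have hη' := (isPiecewiseSolution_const_iff hh).1 hη
  have hkτ : ∀ k : ℕ, k ≤ n → k * h ^ 2 ≤ τ := fun k hk => by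
    rw [← hnh]; gcongr
  have hstep : ∀ k < n, ‖η ((4 * (k + 1) : ℕ) * h) - y ((k + 1 : ℕ) * h ^ 2)‖
      ≤ (1 + 4 * M ^ 2 * h ^ 2) * ‖η ((4 * k : ℕ) * h) - y (k * h ^ 2)‖
        + (C + 8 * M ^ 4 + 1) * h ^ 3 := by
    intro k hk
    have hmod : ∀ j, j < 4 → SolvesOn (lieBlock g₁ g₂ (4 * k + j))
        ((4 * k + j : ℕ) * h) ((4 * k + j : ℕ) * h + h) η := fun j hj =>
      hη'.2.2 (4 * k + j) (by omega)
    have hs₀ := hmod 0 (by omega)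
    have hs₁ := hmod 1 (by omega)
    have hs₂ := hmod 2 (by omega)
    have hs₃ := hmod 3 (by omega)
    have c1 : ((4 * k + 1 : ℕ) : ℝ) * h = (4 * k : ℕ) * h + h := by push_cast; ring
    have c2 : ((4 * k + 2 : ℕ) : ℝ) * h = (4 * k : ℕ) * h + h + h := by push_cast; ring
    have c3 : ((4 * k + 3 : ℕ) : ℝ) * h = (4 * k : ℕ) * h + h + h + h := by push_cast; ring
    have c4 : ((4 * (k + 1) : ℕ) : ℝ) * h = (4 * k : ℕ) * h + h + h + h + h := by push_cast; ring
    rw [c1] at hs₁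
    rw [c2] at hs₂
    rw [c3] at hs₃
    simp only [lieBlock, Nat.mul_add_mod, add_zero, Nat.mul_mod_right, Nat.reduceMod, if_true,
      OfNat.ofNat_ne_zero, OfNat.ofNat_ne_one, Nat.reduceEqDiff, one_ne_zero, if_false]
      at hs₀ hs₁ hs₂ hs₃
    have e1 := hcycle g₁ g₂ h₁ h₂ _ h η hh hh1 hs₀ hs₁ hs₂ hs₃
    have c5 : ((k + 1 : ℕ) : ℝ) * h ^ 2 = k * h ^ 2 + h ^ 2 := by push_cast; ring
    have e2 := h₁.norm_euler_sub_le h₂ (sq_nonneg h)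
      (hy.mono (c := k * h ^ 2) (by positivity) (c5 ▸ hkτ (k + 1) hk))
    rw [c4, c5]
    set u := η ((4 * k : ℕ) * h)
    set w := y (k * h ^ 2)
    have e3 := h₁.norm_lieBracket_sub_le h₂ u w
    have hh4 : (h ^ 2) ^ 2 ≤ h ^ 3 := by
      calc (h ^ 2) ^ 2 = h ^ 3 * h := by ring
        _ ≤ h ^ 3 * 1 := by gcongr
        _ = h ^ 3 := mul_one _
    calc ‖η ((4 * k : ℕ) * h + h + h + h + h) - y (k * h ^ 2 + h ^ 2)‖
        = ‖(η ((4 * k : ℕ) * h + h + h + h + h) - (u + h ^ 2 • lieBracket g₁ g₂ u))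
          - (y (k * h ^ 2 + h ^ 2) - (w + h ^ 2 • lieBracket g₁ g₂ w)) + (u - w)
          + h ^ 2 • (lieBracket g₁ g₂ u - lieBracket g₁ g₂ w)‖ := by
          congr 1; module
      _ ≤ C * h ^ 3 + 8 * M ^ 4 * (h ^ 2) ^ 2 + ‖u - w‖ + h ^ 2 * (4 * M ^ 2 * ‖u - w‖) := by
          refine norm_add_le_of_le (norm_add_le_of_le (norm_sub_le_of_le e1 e2) le_rfl) ?_
          rw [norm_smul, Real.norm_of_nonneg (sq_nonneg h)]
          gcongr
      _ ≤ C * h ^ 3 + 8 * M ^ 4 * h ^ 3 + ‖u - w‖ + h ^ 2 * (4 * M ^ 2 * ‖u - w‖) := by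
          gcongr
      _ ≤ _ := by
          have : 0 ≤ h ^ 3 := by positivity
          linarith
  have hgrid : ∀ k ≤ n, ‖η ((4 * k : ℕ) * h) - y (k * h ^ 2)‖
      ≤ (C + 8 * M ^ 4 + 1) * τ * Real.exp ((4 * M ^ 2 + 1) * τ) * h := by
    intro k hk
    refine (le_mul_exp_of_le_one_add_mul
      (e := fun k : ℕ => ‖η ((4 * k : ℕ) * h) - y (k * h ^ 2)‖) (a := 4 * M ^ 2 * h ^ 2)
      (b := (C + 8 * M ^ 4 + 1) * h ^ 3) (n := n) (by positivity) (by positivity)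
      (by simp [hη'.2.1, hy0]) hstep k hk).trans ?_
    calc k * ((C + 8 * M ^ 4 + 1) * h ^ 3) * Real.exp (4 * M ^ 2 * h ^ 2 * k)
        = (C + 8 * M ^ 4 + 1) * (k * h ^ 2) * Real.exp (4 * M ^ 2 * (k * h ^ 2)) * h := by ring_nf
      _ ≤ (C + 8 * M ^ 4 + 1) * τ * Real.exp ((4 * M ^ 2 + 1) * τ) * h := by
          gcongr
          · exact hkτ k hk
          · linarith
          · exact hkτ k hk
  refine ⟨by simpa only [hnh] using hgrid n le_rfl, fun i hi t ht => ?_⟩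
  refine ⟨(i / 4 : ℕ) * h ^ 2, ⟨by positivity, hkτ _ (by omega)⟩, ?_⟩
  have e1 := (hg i).norm_curve_sub_le (hη'.2.2 i hi) t ht
  have e2 := hη.norm_sub_le hg hh (k := 4 * (i / 4)) (j := i % 4) (by omega)
  rw [Nat.div_add_mod] at e2
  have e3 := hgrid (i / 4) (by omega)
  have hj : ((i % 4 : ℕ) : ℝ) ≤ 3 := by exact_mod_cast (by omega : i % 4 ≤ 3)
  calc ‖η t - y ((i / 4 : ℕ) * h ^ 2)‖
      ≤ ‖η t - η (i * h)‖ + ‖η (i * h) - η ((4 * (i / 4) : ℕ) * h)‖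
        + ‖η ((4 * (i / 4) : ℕ) * h) - y ((i / 4 : ℕ) * h ^ 2)‖ := by
        refine (norm_sub_le_norm_sub_add_norm_sub _ _ _).trans (add_le_add_left ?_ _)
        exact norm_sub_le_norm_sub_add_norm_sub _ _ _
    _ ≤ M * h + 3 * (M * h)
        + (C + 8 * M ^ 4 + 1) * τ * Real.exp ((4 * M ^ 2 + 1) * τ) * h := by
        refine add_le_add (add_le_add (e1.trans ?_) (e2.trans ?_)) e3
        · gcongr
          linarith [ht.2]
        · gcongr
    _ = _ := by ring

end Euclidean

/-- An eventual estimate, monotone in its two constants, that holds locally on a compact set holds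
on the whole set. -/
theorem exists_uniform_const_of_locally {X : Type*} [TopologicalSpace X] {K : Set X}
    (hK : IsCompact K) {P : ℝ → ℝ → ℕ → X → Prop}
    (hmono : ∀ C C' L L' n x, 0 < C → C ≤ C' → L ≤ L' → P C L n x → P C' L' n x)
    (hloc : ∀ x ∈ K, ∃ U ∈ 𝓝[K] x, ∃ (N : ℕ) (C L : ℝ), 0 < C ∧ 0 < L ∧
      ∀ n : ℕ, N < n → ∀ z ∈ U, P C L n z) :
    ∃ (N : ℕ) (C L : ℝ), 0 < C ∧ 0 < L ∧ ∀ n : ℕ, N < n → ∀ x ∈ K, P C L n x := by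
  refine hK.induction_on (p := fun S => ∃ (N : ℕ) (C L : ℝ), 0 < C ∧ 0 < L ∧
    ∀ n : ℕ, N < n → ∀ x ∈ S, P C L n x) ?_ ?_ ?_ hloc
  · exact ⟨0, 1, 1, one_pos, one_pos, by simp⟩
  · rintro S T hST ⟨N, C, L, hC, hL, h⟩
    exact ⟨N, C, L, hC, hL, fun n hn x hx => h n hn x (hST hx)⟩
  · rintro S T ⟨N, C, L, hC, hL, h⟩ ⟨N', C', L', hC', hL', h'⟩
    refine ⟨max N N', max C C', max L L', lt_max_of_lt_left hC, lt_max_of_lt_left hL,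
      fun n hn x hx => ?_⟩
    rcases hx with hx | hx
    · exact hmono _ _ _ _ _ _ hC (le_max_left _ _) (le_max_left _ _)
        (h n ((le_max_left _ _).trans_lt hn) x hx)
    · exact hmono _ _ _ _ _ _ hC' (le_max_right _ _) (le_max_right _ _)
        (h' n ((le_max_right _ _).trans_lt hn) x hx)

/-- the flow of the Lie bracket `[f₁, f₂]` is approximated, at rate `O(√Δt)`, by
cycling `n` times through the flows of `−f₁, −f₂, f₁, f₂`, each for time `√Δt`, `Δt = τ/n`. -/
theorem lie_bracket_flow_approximation
    (d : ℕ) (hd : 1 ≤ d) (f₁ f₂ : Euc d → Euc d)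
    (hf₁ : ContDiff ℝ (⊤ : ℕ∞) f₁) (hf₂ : ContDiff ℝ (⊤ : ℕ∞) f₂)
    (D : Set (Euc d)) (hD : IsOpen D) (τ : ℝ) (hτ : 0 < τ)
    (γ : Euc d → ℝ → Euc d)
    (hγ0 : ∀ x ∈ D, γ x 0 = x)
    (hγD : ∀ x ∈ D, ∀ t ∈ Set.Icc (0 : ℝ) τ, γ x t ∈ D)
    (hγ : ∀ x ∈ D, ∀ t ∈ Set.Icc (0 : ℝ) τ,
      HasDerivAt (γ x) (lieBracket f₁ f₂ (γ x t)) t)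
    (K : Set (Euc d)) (hK : K ⊆ D) (hKc : IsCompact K) :
    ∃ (N : ℕ) (C L : ℝ), 0 < C ∧ 0 < L ∧
      ∀ n : ℕ, N < n → ∀ x ∈ K,
        (∃ η : ℝ → Euc d,
          IsPiecewiseSolution (4 * n) (lieBlock f₁ f₂) (fun _ => Real.sqrt (τ / n)) x η) ∧
        (∀ η : ℝ → Euc d,
          IsPiecewiseSolution (4 * n) (lieBlock f₁ f₂) (fun _ => Real.sqrt (τ / n)) x η →
          ‖η ((4 * n : ℕ) * Real.sqrt (τ / n)) - γ x τ‖
            ≤ C * τ * Real.exp (L * τ) * Real.sqrt (τ / n)) := by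
  refine exists_uniform_const_of_locally hKc ?_ fun x₀ hx₀ => ?_
  · refine fun C C' L L' n x hC hCC' hLL' h => ⟨h.1, fun η hη => (h.2 η hη).trans ?_⟩
    have := hC.le.trans hCC'
    gcongr
  have hx₀D := hK hx₀
  have hsolves : ∀ x ∈ D, SolvesOn (lieBracket f₁ f₂) 0 τ (γ x) := fun x hx =>
    ⟨fun t ht => (hγ x hx t ht).continuousAt.continuousWithinAt,
      fun t ht => hγ x hx t (Ioo_subset_Icc_self ht)⟩
  obtain ⟨R, hR⟩ := isCompact_Icc.exists_bound_of_continuousOn (hsolves x₀ hx₀D).1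
  obtain ⟨M₁, g₁, hM₁, hg₁⟩ := exists_isC2Bounded_eventuallyEq hf₁ (R + 2)
  obtain ⟨M₂, g₂, hM₂, hg₂⟩ := exists_isC2Bounded_eventuallyEq hf₂ (R + 2)
  set M := max M₁ M₂
  have h₁ : IsC2Bounded M g₁ := hM₁.mono (le_max_left _ _)
  have h₂ : IsC2Bounded M g₂ := hM₂.mono (le_max_right _ _)
  have hM := h₁.nonneg
  have hLip := h₁.lipschitzWith_lieBracket h₂
  have hbr : ∀ z, ‖z‖ ≤ R + 2 → lieBracket g₁ g₂ z = lieBracket f₁ f₂ z := fun z hz =>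
    lieBracket_eq_of_eventuallyEq (hg₁ z hz) (hg₂ z hz)
  obtain ⟨C, L, hC, hL, hCL⟩ := IsC2Bounded.exists_norm_piecewise_sub_le (d := d) M
  have hsolves₀ : SolvesOn (lieBracket g₁ g₂) 0 τ (γ x₀) := (hsolves x₀ hx₀D).congr fun t ht =>
    (hbr _ ((hR t (Ioo_subset_Icc_self ht)).trans (by linarith))).symm
  obtain ⟨δ, hδ, hδexp⟩ : ∃ δ : ℝ, 0 < δ ∧ δ * Real.exp ((4 * M ^ 2).toNNReal * τ) ≤ 1 :=
    ⟨(Real.exp ((4 * M ^ 2).toNNReal * τ))⁻¹, by positivity,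
      (inv_mul_cancel₀ (Real.exp_pos _).ne').le⟩
  have hnear : ∀ x ∈ D, dist x x₀ ≤ δ →
      SolvesOn (lieBracket g₁ g₂) 0 τ (γ x) ∧ ∀ t ∈ Icc 0 τ, ‖γ x t‖ ≤ R + 1 := by
    intro x hx hxδ
    obtain ⟨y, hy0, hy⟩ := exists_solvesOn (h₁.norm_lieBracket_le h₂) hLip hτ.le x
    have hyR : ∀ t ∈ Icc 0 τ, ‖y t‖ ≤ R + 1 := by
      intro t ht
      have := dist_le_of_trajectories_ODE (v := fun _ => lieBracket g₁ g₂) (fun _ => hLip)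
        hy.1 (hy.hasDerivWithinAt hLip.continuous) hsolves₀.1
        (hsolves₀.hasDerivWithinAt hLip.continuous)
        (δ := δ) (by rwa [hy0, hγ0 x₀ hx₀D]) t ht
      have h1 : dist (y t) (γ x₀ t) ≤ 1 := by
        refine this.trans (le_trans ?_ hδexp)
        gcongr
        linarith [ht.2]
      have h2 := norm_le_norm_add_norm_sub' (y t) (γ x₀ t)
      rw [← dist_eq_norm] at h2
      linarith [hR t ht]
    have heq : EqOn y (γ x) (Icc 0 τ) := by
      refine SolvesOn.eqOn (contDiff_lieBracket hf₁ hf₂) (hy.congr fun t ht => ?_) (hsolves x hx)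
        (by rw [hy0, hγ0 x hx])
      exact hbr _ ((hyR t (Ioo_subset_Icc_self ht)).trans (by linarith))
    have hγR : ∀ t ∈ Icc 0 τ, ‖γ x t‖ ≤ R + 1 := fun t ht => heq ht ▸ hyR t ht
    exact ⟨(hsolves x hx).congr fun t ht =>
      (hbr _ ((hγR t (Ioo_subset_Icc_self ht)).trans (by linarith))).symm, hγR⟩
  set B : ℝ := C * τ * Real.exp (L * τ) + 4 * M
  have hB : 0 ≤ B := by positivity
  refine ⟨K ∩ Metric.closedBall x₀ δ, inter_mem_nhdsWithin _ (Metric.closedBall_mem_nhds _ hδ),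
    ⌈τ + τ * B ^ 2⌉₊, C, L, hC, hL, fun n hn x hx => ?_⟩
  have hn' : τ + τ * B ^ 2 < n := (Nat.le_ceil _).trans_lt (by exact_mod_cast hn)
  have hτB : 0 ≤ τ * B ^ 2 := by positivity
  have hn0 : (0 : ℝ) < n := by linarith
  have hh : B * Real.sqrt (τ / n) ≤ 1 := by
    rw [← Real.sqrt_sq hB, ← Real.sqrt_mul (sq_nonneg B), Real.sqrt_le_one, ← mul_div_assoc,
      div_le_one hn0]
    linarith
  have hxD := hK hx.1
  obtain ⟨hγs, hγR⟩ := hnear x hxD hx.2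
  have hs0 := Real.sqrt_nonneg (τ / n)
  obtain ⟨η, hη⟩ := exists_isPiecewiseSolution hs0 (fun i z => exists_solvesOn
    (h₁.lieBlock_apply h₂ i).norm_le (h₁.lieBlock_apply h₂ i).lipschitzWith hs0 z) (4 * n) x
  obtain ⟨hend, htube⟩ := hCL g₁ g₂ h₁ h₂ τ hτ n (by linarith) x (γ x) η (hγ0 x hxD) hγs hη
  have hηf : IsPiecewiseSolution (4 * n) (lieBlock f₁ f₂) (fun _ => Real.sqrt (τ / n)) x η := by
    rw [isPiecewiseSolution_const_iff hs0] at hη ⊢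
    refine ⟨hη.1, hη.2.1, fun i hi => (hη.2.2 i hi).congr fun t ht => ?_⟩
    obtain ⟨s, hs, hst⟩ := htube i hi t (Ioo_subset_Icc_self ht)
    have hηR : ‖η t‖ ≤ R + 2 := by
      have := norm_le_norm_add_norm_sub' (η t) (γ x s)
      linarith [hγR s hs]
    exact lieBlock_eq_of_eventuallyEq (hg₁ _ hηR) (hg₂ _ hηR) i
  refine ⟨⟨η, hηf⟩, fun ζ hζ => ?_⟩
  rw [hζ.eq_of_contDiff hs0 (contDiff_lieBlock hf₁ hf₂) hηf (4 * n) le_rfl]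
  exact hend
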